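/- For any prime p ≥ 5 and nonnegative integers k, s, the Gaussian binomial coefficient satisfies C(kp, sp)_q ≡ q^{(k−s)s·C(p,2)} · ( C(k,s)_{q^p} + k·C(k, s+1)·C(s+1,2)·((p^2−1)/12)·(q^p − 1)^2 ) modulo [p]_q^3 in ℤ[q]. -/

import Mathlib

open Polynomial Finset

noncomputable def qInt (n : ℕ) : Polynomial ℤ := ∑ i ∈ Finset.range n, X ^ i

noncomputable def qBinom : ℕ → ℕ → Polynomial ℤ
  | _, 0 => 1
  | 0, _ + 1 => 0
  | n + 1, k + 1 => qBinom n k + X ^ (k + 1) * qBinom n (k + 1)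

/-- To first order in `u`, `∏ (a i + u)` is `∏ a i + u * e` for an `e` depending only on `a`. -/
lemma exists_prod_add_eq_of_sq_eq_zero {R : Type} [CommRing R] (a : ℕ → R) (m : ℕ) :
    ∃ e : R, ∀ (S : Type) [CommRing S] (f : R →+* S) (u : S), u ^ 2 = 0 →
      ∏ i ∈ range m, (f (a i) + u) = f (∏ i ∈ range m, a i) + u * f e := by
  induction m with
  | zero => exact ⟨0, fun S _ f u _ => by simp⟩
  | succ m ih =>
    obtain ⟨e, he⟩ := ih
    refine ⟨e * a m + ∏ i ∈ range m, a i, fun S _ f u hu => ?_⟩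
    rw [prod_range_succ, he S f u hu, prod_range_succ, map_mul, map_add, map_mul]
    linear_combination f e * hu

lemma prod_one_sub_mul_pow_eq_prod_pairs {S : Type*} [CommRing S] (q w : S) (m : ℕ) :
    ∏ i ∈ range (2 * m), (1 - w * q ^ (i + 1)) =
      ∏ i ∈ range m, (w * ((1 - q ^ (i + 1)) * (1 - q ^ (2 * m - i))) +
        (1 - w) * (1 - w * q ^ (2 * m + 1))) := by
  rw [two_mul, prod_range_add, ← prod_range_reflect (fun i => 1 - w * q ^ (m + i + 1)),
    ← prod_mul_distrib]
  refine prod_congr rfl fun i hi => ?_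
  have hi := mem_range.1 hi
  have h1 : m + (m - 1 - i) + 1 = m + m - i := by omega
  have h2 : q ^ (m + m + 1) = q ^ (i + 1) * q ^ (m + m - i) := by
    rw [← pow_add]; congr 1; omega
  rw [h1, h2]
  ring

lemma qBinom_eq_zero_of_lt {n k : ℕ} (h : n < k) : qBinom n k = 0 := by
  induction n generalizing k with
  | zero => obtain ⟨k, rfl⟩ := Nat.exists_eq_succ_of_ne_zero h.ne'; simp [qBinom]
  | succ n ih =>
    obtain ⟨k, rfl⟩ := Nat.exists_eq_succ_of_ne_zero (Nat.ne_zero_of_lt h)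
    simp [qBinom, ih (show n < k by omega), ih (show n < k + 1 by omega)]

lemma qBinom_self (n : ℕ) : qBinom n n = 1 := by
  induction n with
  | zero => simp [qBinom]
  | succ n ih => simp [qBinom, ih, qBinom_eq_zero_of_lt]

lemma qBinom_mul_prod_mul_prod (d s : ℕ) :
    qBinom (d + s) s * (∏ i ∈ range s, (1 - X ^ (i + 1))) * ∏ i ∈ range d, (1 - X ^ (i + 1)) =
      ∏ i ∈ range (d + s), (1 - X ^ (i + 1)) := by
  obtain ⟨n, hn⟩ : ∃ n, d + s = n := ⟨_, rfl⟩
  induction n generalizing d s with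
  | zero =>
    obtain ⟨rfl, rfl⟩ : d = 0 ∧ s = 0 := by omega
    simp [qBinom]
  | succ n ih =>
    rcases s with _ | s
    · simp [qBinom]
    rcases d with _ | d
    · simp [qBinom_self]
    have h1 := ih (d + 1) s (by omega)
    have h2 := ih d (s + 1) (by omega)
    have e1 : d + 1 + s = n := by omega
    have e2 : d + (s + 1) = n := by omega
    have e3 : d + 1 + (s + 1) = n + 1 := by omega
    rw [e1] at h1
    rw [e2] at h2
    rw [e3, qBinom, prod_range_succ _ n]
    have e4 : (X : ℤ[X]) ^ (n + 1) = X ^ (s + 1) * X ^ (d + 1) := by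
      rw [← pow_add]; congr 1; omega
    rw [e4]
    rw [prod_range_succ] at h1 h2 ⊢
    rw [prod_range_succ _ d]
    linear_combination (1 - X ^ (s + 1)) * h1 + X ^ (s + 1) * (1 - X ^ (d + 1)) * h2

lemma prod_one_sub_pow_mul {S : Type*} [CommRing S] (q : S) (r n : ℕ) :
    ∏ i ∈ range (n * (r + 1)), (1 - q ^ (i + 1)) =
      (∏ j ∈ range n, (1 - (q ^ (r + 1)) ^ (j + 1))) *
        ∏ j ∈ range n, ∏ i ∈ range r, (1 - (q ^ (r + 1)) ^ j * q ^ (i + 1)) := by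
  induction n with
  | zero => simp
  | succ n ih =>
    have h : ∀ i, q ^ (n * (r + 1) + i + 1) = (q ^ (r + 1)) ^ n * q ^ (i + 1) := fun i => by
      rw [← pow_mul, ← pow_add]; congr 1; ring
    rw [Nat.succ_mul, prod_range_add, ih, prod_range_succ _ n, prod_range_succ _ n]
    simp only [h]
    rw [prod_range_succ _ r]
    have h' : (q ^ (r + 1)) ^ n * q ^ (r + 1) = (q ^ (r + 1)) ^ (n + 1) := by ring
    rw [h']
    ring

lemma qBinom_mul_mul_prod (r d s : ℕ) :
    qBinom ((d + s) * (r + 1)) (s * (r + 1)) *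
        (∏ j ∈ range s, ∏ i ∈ range r, (1 - (X ^ (r + 1)) ^ j * X ^ (i + 1))) *
        (∏ j ∈ range d, ∏ i ∈ range r, (1 - (X ^ (r + 1)) ^ j * X ^ (i + 1))) =
      (qBinom (d + s) s).comp (X ^ (r + 1)) *
        ∏ j ∈ range (d + s), ∏ i ∈ range r, (1 - (X ^ (r + 1)) ^ j * X ^ (i + 1)) := by
  have hne : ∀ n, ∏ j ∈ range n, (1 - ((X : ℤ[X]) ^ (r + 1)) ^ (j + 1)) ≠ 0 := fun n => by
    refine prod_ne_zero_iff.2 fun j _ h => ?_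
    have := congrArg (Polynomial.eval 0) h
    simp at this
  have h1 := qBinom_mul_prod_mul_prod (d * (r + 1)) (s * (r + 1))
  have h2 := congrArg (fun f => f.comp ((X : ℤ[X]) ^ (r + 1))) (qBinom_mul_prod_mul_prod d s)
  simp only [mul_comp, Polynomial.prod_comp, sub_comp, one_comp, pow_comp, X_comp] at h2
  rw [← add_mul] at h1
  simp only [prod_one_sub_pow_mul] at h1
  refine mul_left_cancel₀ (mul_ne_zero (hne s) (hne d)) ?_
  linear_combination h1 - (∏ j ∈ range (d + s), ∏ i ∈ range r,
    (1 - (X ^ (r + 1)) ^ j * X ^ (i + 1))) * h2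

lemma eval₂_qBinom_mul_of_mul_eq {S : Type*} [CommRing S] (f : ℤ →+* S) {Q v : S}
    (h : Q * v = v) (n k : ℕ) : (qBinom n k).eval₂ f Q * v = n.choose k * v := by
  induction n generalizing k with
  | zero => rcases k with _ | k <;> simp [qBinom]
  | succ n ih =>
    rcases k with _ | k
    · simp [qBinom]
    have hk : ∀ j : ℕ, Q ^ j * v = v := fun j => by
      induction j with
      | zero => simp
      | succ j ihj => rw [pow_succ, mul_assoc, h, ihj]
    rw [qBinom, eval₂_add, eval₂_mul, eval₂_X_pow, Nat.choose_succ_succ, Nat.cast_add]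
    linear_combination ih k + Q ^ (k + 1) * ih (k + 1) + (n.choose (k + 1) : S) * hk (k + 1)

lemma IsPrimitiveRoot.prod_one_sub_mul_pow {R : Type*} [CommRing R] [IsDomain R] {ζ : R} {r : ℕ}
    (hζ : IsPrimitiveRoot ζ (r + 1)) {x : R} (hx : x ≠ 1) :
    ∏ i ∈ range r, (1 - x * ζ ^ (i + 1)) = ∑ j ∈ range (r + 1), x ^ j := by
  classical
  have h := hζ.pow_sub_pow_eq_prod_sub_mul 1 x r.succ_pos
  have hr : nthRootsFinset (r + 1) (1 : R) = (range (r + 1)).image (ζ ^ ·) := by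
    ext y
    simp [-Multiset.range_succ, nthRootsFinset, hζ.nthRoots_eq (one_pow (r + 1))]
  rw [hr, prod_image (fun i hi j hj hij => hζ.pow_inj (mem_range.1 hi) (mem_range.1 hj) hij),
    prod_range_succ'] at h
  refine mul_right_cancel₀ (sub_ne_zero.2 hx) ?_
  rw [geom_sum_mul]
  simp only [one_pow, pow_zero, one_mul] at h
  simp only [mul_comm x]
  rw [Nat.succ_eq_add_one] at h
  linear_combination h

lemma sum_range_coeff_one_add_X_pow (R : Type*) [CommRing R] (n k : ℕ) :
    (∑ j ∈ range n, (1 + X : R[X]) ^ j).coeff k = (n.choose (k + 1) : R) := by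
  induction n with
  | zero => simp
  | succ n ih =>
    rw [sum_range_succ, coeff_add, ih, coeff_one_add_X_pow, Nat.choose_succ_succ]
    push_cast
    ring

lemma two_mul_cast_choose_two {R : Type*} [CommRing R] (n : ℕ) :
    2 * (n.choose 2 : R) = n * (n - 1) := by
  induction n with
  | zero => simp
  | succ n ih =>
    rw [Nat.choose_succ_succ, Nat.choose_one_right]
    push_cast
    linear_combination ih

lemma six_mul_cast_choose_three {R : Type*} [CommRing R] (n : ℕ) :
    6 * (n.choose 3 : R) = n * (n - 1) * (n - 2) := by
  induction n with
  | zero => simp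
  | succ n ih =>
    rw [Nat.choose_succ_succ]
    push_cast
    linear_combination ih + 3 * two_mul_cast_choose_two (R := R) n

/-- The coefficient `e` of `exists_prod_add_eq_of_sq_eq_zero` and the product itself, for the
pairs `(1 - ζ ^ (i + 1)) * (1 - ζ ^ (2 * m - i))` at a primitive root of unity of odd order. -/
lemma IsPrimitiveRoot.prod_pairs_eq {K : Type} [Field K] {ζ : K} {m : ℕ}
    (hζ : IsPrimitiveRoot ζ (2 * m + 1)) {c e : K}
    (h : ∀ u : K[X] ⧸ Ideal.span {(X : K[X]) ^ 3}, u ^ 2 = 0 →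
      ∏ i ∈ range m, (Ideal.Quotient.mk _ (C ((1 - ζ ^ (i + 1)) * (1 - ζ ^ (2 * m - i)))) + u) =
        Ideal.Quotient.mk _ (C c) + u * Ideal.Quotient.mk _ (C e)) :
    c = 2 * m + 1 ∧ 6 * e = (2 * m + 1) * m * (m + 1) := by
  have hpX : (1 + X : K[X]) ≠ 1 := by simp
  have h1 := (hζ.map_of_injective (C_injective (R := K))).prod_one_sub_mul_pow hpX
  have hz : (Ideal.Quotient.mk (Ideal.span {(X : K[X]) ^ 3}) X) ^ 3 = 0 := by
    rw [← map_pow, Ideal.Quotient.eq_zero_iff_mem]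
    exact Ideal.mem_span_singleton_self _
  rw [prod_one_sub_mul_pow_eq_prod_pairs, ← map_pow C, hζ.pow_eq_one] at h1
  have h2 : Ideal.Quotient.mk (Ideal.span {(X : K[X]) ^ 3})
      (∑ j ∈ range (2 * m + 1), (1 + X : K[X]) ^ j) =
      Ideal.Quotient.mk _ ((1 + X) ^ m * (C c + X ^ 2 * C e)) := by
    have h3 := h (Ideal.Quotient.mk _ X ^ 2) (by linear_combination Ideal.Quotient.mk _ X * hz)
    rw [← h1, map_prod, map_mul, map_add, map_mul, map_pow, map_pow, ← h3, ← card_range m,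
      ← prod_const, card_range, ← prod_mul_distrib]
    refine prod_congr rfl fun i _ => ?_
    simp only [map_add, map_mul, map_sub, map_pow, map_one]
    linear_combination -hz
  rw [Ideal.Quotient.eq, Ideal.mem_span_singleton, X_pow_dvd_iff] at h2
  have e0 := h2 0 (by norm_num)
  have e2 := h2 2 (by norm_num)
  rw [coeff_sub, sum_range_coeff_one_add_X_pow, mul_add, ← mul_assoc, coeff_add, coeff_mul_C,
    coeff_mul_C, coeff_one_add_X_pow, coeff_mul_X_pow'] at e0 e2
  simp only [coeff_one_add_X_pow] at e0 e2
  norm_num at e0 e2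
  have hc : c = 2 * m + 1 := by linear_combination -e0
  refine ⟨hc, ?_⟩
  have h6 := six_mul_cast_choose_three (R := K) (2 * m + 1)
  have h4 := two_mul_cast_choose_two (R := K) m
  push_cast at h6
  rw [hc] at e2
  linear_combination -6 * e2 + h6 - 3 * (2 * m + 1) * h4

lemma choose_two_add (d s : ℕ) : (d + s).choose 2 = d.choose 2 + s.choose 2 + d * s := by
  have h := two_mul_cast_choose_two (R := ℤ) (d + s)
  have hd := two_mul_cast_choose_two (R := ℤ) d
  have hs := two_mul_cast_choose_two (R := ℤ) s
  zify
  push_cast at h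
  refine mul_left_cancel₀ two_ne_zero ?_
  linear_combination h - hd - hs

lemma two_mul_choose_three_add (d s : ℕ) :
    2 * (d + s + 1).choose 3 =
      2 * (d + 1).choose 3 + 2 * (s + 1).choose 3 + d * s * (d + s) := by
  have h := six_mul_cast_choose_three (R := ℤ) (d + s + 1)
  have hd := six_mul_cast_choose_three (R := ℤ) (d + 1)
  have hs := six_mul_cast_choose_three (R := ℤ) (s + 1)
  zify
  push_cast at h hd hs
  refine mul_left_cancel₀ three_ne_zero ?_
  linear_combination h - hd - hs

lemma mul_choose_succ_mul_choose_two (d s : ℕ) :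
    2 * ((d + s).choose (s + 1) * (s + 1).choose 2) = (d + s).choose s * (d * s) := by
  have h := Nat.choose_succ_right_eq (d + s) s
  have hs := two_mul_cast_choose_two (R := ℤ) (s + 1)
  rw [Nat.add_sub_cancel] at h
  zify at h ⊢
  push_cast at hs
  linear_combination (s : ℤ) * h + ((d + s).choose (s + 1) : ℤ) * hs

lemma pow_mul_sq_of_cube_eq_zero {B : Type*} [CommRing B] {Q : B} (h : (Q - 1) ^ 3 = 0) (n : ℕ) :
    Q ^ n * (Q - 1) ^ 2 = (Q - 1) ^ 2 := by
  induction n with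
  | zero => simp
  | succ n ih => linear_combination Q ^ n * h + ih

lemma one_sub_pow_mul_one_sub_pow_succ {B : Type*} [CommRing B] {Q : B} (h : (Q - 1) ^ 3 = 0)
    (n : ℕ) : (1 - Q ^ n) * (1 - Q ^ (n + 1)) = 2 * ((n + 1).choose 2 : B) * (Q - 1) ^ 2 := by
  have hn : ∀ n : ℕ, Q ^ n = 1 + n * (Q - 1) + n.choose 2 * (Q - 1) ^ 2 := fun n => by
    induction n with
    | zero => simp
    | succ n ih =>
      rw [pow_succ, ih, Nat.choose_succ_succ, Nat.choose_one_right]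
      push_cast
      linear_combination (n.choose 2 : B) * h
  have h2 := two_mul_cast_choose_two (R := B) (n + 1)
  rw [hn n, hn (n + 1)]
  push_cast at h2 ⊢
  linear_combination ((n : B) * (n + 1).choose 2 + (n + 1) * n.choose 2 +
    (n.choose 2) * (n + 1).choose 2 * (Q - 1)) * h - (Q - 1) ^ 2 * h2

section
variable {B : Type*} [CommRing B] {q c e : B} {m : ℕ} {t : ℤ}

lemma prod_one_sub_pow_mul_pow (h : (q ^ (2 * m + 1) - 1) ^ 3 = 0)
    (hc : ∀ u : B, u ^ 2 = 0 →
      ∏ i ∈ range m, ((1 - q ^ (i + 1)) * (1 - q ^ (2 * m - i)) + u) = c + u * e)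
    (he : (q ^ (2 * m + 1) - 1) ^ 2 * e = (q ^ (2 * m + 1) - 1) ^ 2 * (t * c)) (n : ℕ) :
    ∏ i ∈ range (2 * m), (1 - (q ^ (2 * m + 1)) ^ n * q ^ (i + 1)) =
      (q ^ (2 * m + 1)) ^ (m * n) * c *
        (1 + 2 * ((n + 1).choose 2 : B) * t * (q ^ (2 * m + 1) - 1) ^ 2) := by
  rw [prod_one_sub_mul_pow_eq_prod_pairs]
  set Q := q ^ (2 * m + 1)
  have hu := one_sub_pow_mul_one_sub_pow_succ h n
  have hv : (2 * ((n + 1).choose 2 : B) * (Q - 1) ^ 2) ^ 2 = 0 := by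
    linear_combination (2 * ((n + 1).choose 2 : B)) ^ 2 * (Q - 1) * h
  have hw := pow_mul_sq_of_cube_eq_zero h n
  rw [← pow_succ, hu]
  calc _ = ∏ i ∈ range m, (Q ^ n * ((1 - q ^ (i + 1)) * (1 - q ^ (2 * m - i)) +
        2 * ((n + 1).choose 2 : B) * (Q - 1) ^ 2)) := by
        refine prod_congr rfl fun i _ => ?_
        linear_combination -2 * ((n + 1).choose 2 : B) * hw
    _ = _ := by
        rw [prod_mul_distrib, hc _ hv, prod_const, card_range, ← pow_mul, mul_comm n m]
        linear_combination Q ^ (m * n) * (2 * ((n + 1).choose 2 : B)) * he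

lemma prod_prod_one_sub_pow_mul_pow (h : (q ^ (2 * m + 1) - 1) ^ 3 = 0)
    (hc : ∀ u : B, u ^ 2 = 0 →
      ∏ i ∈ range m, ((1 - q ^ (i + 1)) * (1 - q ^ (2 * m - i)) + u) = c + u * e)
    (he : (q ^ (2 * m + 1) - 1) ^ 2 * e = (q ^ (2 * m + 1) - 1) ^ 2 * (t * c)) (n : ℕ) :
    ∏ j ∈ range n, ∏ i ∈ range (2 * m), (1 - (q ^ (2 * m + 1)) ^ j * q ^ (i + 1)) =
      (q ^ (2 * m + 1)) ^ (m * n.choose 2) * c ^ n *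
        (1 + (2 * (n + 1).choose 3 : ℕ) * t * (q ^ (2 * m + 1) - 1) ^ 2) := by
  induction n with
  | zero => simp [Nat.choose]
  | succ n ih =>
    rw [prod_range_succ, ih, prod_one_sub_pow_mul_pow h hc he, Nat.choose_succ_succ (n + 1) 2,
      Nat.choose_succ_succ n 1, Nat.choose_one_right, mul_add m, pow_add]
    push_cast
    linear_combination (q ^ (2 * m + 1)) ^ (m * n) * (q ^ (2 * m + 1)) ^ (m * n.choose 2) *
      c ^ (n + 1) * 4 * (n + 1).choose 3 * (n + n.choose 2) * t ^ 2 *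
      (q ^ (2 * m + 1) - 1) * h
end

lemma qInt_dvd_iff_aeval_eq_zero {p : ℕ} (hp : p.Prime) {ζ : ℂ} (hζ : IsPrimitiveRoot ζ p)
    (f : ℤ[X]) : qInt p ∣ f ↔ aeval ζ f = 0 := by
  have := Fact.mk hp
  rw [qInt, ← cyclotomic_prime ℤ p, cyclotomic_eq_minpoly hζ hp.pos,
    minpoly.isIntegrallyClosed_dvd_iff (hζ.isIntegral hp.pos)]

lemma prime_qInt {p : ℕ} (hp : p.Prime) : Prime (qInt p) := by
  have := Fact.mk hp
  rw [qInt, ← cyclotomic_prime ℤ p]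
  exact (cyclotomic.irreducible hp.pos).prime

lemma exists_prod_pairs_add_eq {m t : ℕ} (hp : (2 * m + 1).Prime) (ht : m * (m + 1) = 6 * t) :
    ∃ c e : ℤ[X], (∀ (S : Type) [CommRing S] (f : ℤ[X] →+* S) (u : S), u ^ 2 = 0 →
      ∏ i ∈ range m, ((1 - f X ^ (i + 1)) * (1 - f X ^ (2 * m - i)) + u) = f c + u * f e) ∧
      qInt (2 * m + 1) ∣ e - t * c ∧ ¬ qInt (2 * m + 1) ∣ c := by
  obtain ⟨e, he⟩ := exists_prod_add_eq_of_sq_eq_zero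
    (fun i => ((1 : ℤ[X]) - X ^ (i + 1)) * (1 - X ^ (2 * m - i))) m
  obtain ⟨c, hc⟩ : ∃ c, ∏ i ∈ range m, ((1 : ℤ[X]) - X ^ (i + 1)) * (1 - X ^ (2 * m - i)) = c :=
    ⟨_, rfl⟩
  rw [hc] at he
  simp only [map_mul, map_sub, map_pow, map_one] at he
  have hζ := Complex.isPrimitiveRoot_exp (2 * m + 1) hp.ne_zero
  set ζ := Complex.exp (2 * Real.pi * Complex.I / ((2 * m + 1 : ℕ) : ℂ))
  obtain ⟨h1, h2⟩ := hζ.prod_pairs_eq (c := aeval ζ c) (e := aeval ζ e) fun u hu => by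
    have := he _ (((Ideal.Quotient.mk (Ideal.span {(X : ℂ[X]) ^ 3})).comp C).comp
      (aeval ζ : ℤ[X] →ₐ[ℤ] ℂ).toRingHom) u hu
    simpa using this
  refine ⟨c, e, he, ?_, ?_⟩
  · rw [qInt_dvd_iff_aeval_eq_zero hp hζ, map_sub, map_mul, map_natCast, h1]
    have ht' : (m * (m + 1) : ℂ) = 6 * t := by exact_mod_cast ht
    refine mul_left_cancel₀ (show (6 : ℂ) ≠ 0 by norm_num) ?_
    linear_combination h2 + (2 * m + 1) * ht'
  · rw [qInt_dvd_iff_aeval_eq_zero hp hζ, h1]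
    exact_mod_cast hp.ne_zero

lemma qBinom_eq_of_cube_eq_zero {B : Type*} [CommRing B] (f : ℤ[X] →+* B) {c e : B} {m t : ℕ}
    (h : (f X ^ (2 * m + 1) - 1) ^ 3 = 0) (hreg : IsLeftRegular c)
    (hc : ∀ u : B, u ^ 2 = 0 →
      ∏ i ∈ range m, ((1 - f X ^ (i + 1)) * (1 - f X ^ (2 * m - i)) + u) = c + u * e)
    (he : (f X ^ (2 * m + 1) - 1) ^ 2 * e = (f X ^ (2 * m + 1) - 1) ^ 2 * ((t : ℤ) * c))
    (d s : ℕ) :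
    f (qBinom ((d + s) * (2 * m + 1)) (s * (2 * m + 1))) =
      (f X ^ (2 * m + 1)) ^ (m * (d * s)) * (f ((qBinom (d + s) s).comp (X ^ (2 * m + 1))) +
        (d + s).choose s * (d * s * (d + s)) * t * (f X ^ (2 * m + 1) - 1) ^ 2) := by
  have h1 := congrArg f (qBinom_mul_mul_prod (2 * m) d s)
  simp only [map_mul, map_prod, map_sub, map_one, map_pow] at h1
  simp only [prod_prod_one_sub_pow_mul_pow h hc he] at h1
  have hT : f ((qBinom (d + s) s).comp (X ^ (2 * m + 1))) * (f X ^ (2 * m + 1) - 1) ^ 2 =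
      (d + s).choose s * (f X ^ (2 * m + 1) - 1) ^ 2 := by
    rw [← eval₂_qBinom_mul_of_mul_eq (f.comp C)
      (show f X ^ (2 * m + 1) * (f X ^ (2 * m + 1) - 1) ^ 2 = (f X ^ (2 * m + 1) - 1) ^ 2 by
        linear_combination h), comp, hom_eval₂, map_pow]
  rw [choose_two_add, two_mul_choose_three_add] at h1
  generalize f (qBinom ((d + s) * (2 * m + 1)) (s * (2 * m + 1))) = L at *
  generalize f ((qBinom (d + s) s).comp (X ^ (2 * m + 1))) = T at *
  generalize f X ^ (2 * m + 1) = Q at *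
  have hQ : IsUnit Q := IsUnit.of_mul_eq_one (1 - (Q - 1) + (Q - 1) ^ 2) (by linear_combination h)
  generalize 2 * (d + 1).choose 3 = a at *
  generalize 2 * (s + 1).choose 3 = b at *
  have hcancel := ((hQ.pow (m * (d.choose 2 + s.choose 2))).isRegular.left.mul (hreg.pow (d + s)))
  have h2 : L * (1 + (a + b) * t * (Q - 1) ^ 2) = Q ^ (m * (d * s)) * T *
      (1 + (a + b + d * s * (d + s)) * t * (Q - 1) ^ 2) := by
    refine hcancel ?_
    simp only
    push_cast at h1
    rw [mul_add m, pow_add, pow_add] at *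
    linear_combination h1 - Q ^ (m * d.choose 2) * Q ^ (m * s.choose 2) * c ^ d * c ^ s *
      L * a * b * t ^ 2 * (Q - 1) * h
  linear_combination (1 - (a + b) * t * (Q - 1) ^ 2) * h2 +
    (L * (a + b) ^ 2 * t ^ 2 * (Q - 1) - Q ^ (m * (d * s)) * T * (a + b) *
      (a + b + d * s * (d + s)) * t ^ 2 * (Q - 1)) * h +
    Q ^ (m * (d * s)) * (d * s * (d + s)) * t * hT

theorem pan_q_ljunggren (p : ℕ) (hp : p.Prime) (hp5 : 5 ≤ p) (k s : ℕ) :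
    (qInt p) ^ 3 ∣
      qBinom (k * p) (s * p) -
        X ^ ((k - s) * s * p.choose 2) *
          ((qBinom k s).comp (X ^ p) +
            C ((k : ℤ) * (k.choose (s + 1) : ℤ) * ((s + 1).choose 2 : ℤ) *
                (((p : ℤ) ^ 2 - 1) / 12)) *
              (X ^ p - 1) ^ 2) := by
  rcases lt_or_ge k s with hks | hks
  · rw [qBinom_eq_zero_of_lt hks, qBinom_eq_zero_of_lt (Nat.mul_lt_mul_of_pos_right hks hp.pos),
      Nat.choose_eq_zero_of_lt (show k < s + 1 by omega)]
    simp
  obtain ⟨d, rfl⟩ := Nat.exists_eq_add_of_le' hks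
  rw [Nat.add_sub_cancel]
  obtain ⟨m, rfl⟩ := hp.odd_of_ne_two (by omega)
  obtain ⟨t, ht⟩ : 6 ∣ m * (m + 1) := by
    have h3 : ¬ 3 ∣ 2 * m + 1 := fun h => by
      have := (Nat.prime_dvd_prime_iff_eq Nat.prime_three hp).1 h
      omega
    have hm : m % 6 = 0 ∨ m % 6 = 2 ∨ m % 6 = 3 ∨ m % 6 = 5 := by omega
    rw [Nat.dvd_iff_mod_eq_zero, Nat.mul_mod, Nat.add_mod]
    rcases hm with h | h | h | h <;> simp [h]
  obtain ⟨c, e, hce, hdvd, hndvd⟩ := exists_prod_pairs_add_eq hp ht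
  have hprime := prime_qInt hp
  set Φ := qInt (2 * m + 1) with hΦ
  have hXp : (X : ℤ[X]) ^ (2 * m + 1) - 1 = Φ * (X - 1) := (geom_sum_mul X _).symm
  have h12 : (((2 * m + 1 : ℕ) : ℤ) ^ 2 - 1) / 12 = 2 * t := by
    have : (((2 * m + 1 : ℕ) : ℤ) ^ 2 - 1) = 12 * (2 * t) := by
      zify at ht
      push_cast
      linear_combination 4 * ht
    rw [this, Int.mul_ediv_cancel_left _ (by norm_num)]
  have hch : (2 * m + 1).choose 2 = (2 * m + 1) * m := by
    rw [Nat.choose_two_right, Nat.add_sub_cancel, mul_left_comm, Nat.mul_div_cancel_left _ two_pos]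
  obtain ⟨B, _, f, hsurj, hf⟩ : ∃ (B : Type) (_ : CommRing B) (f : ℤ[X] →+* B),
      Function.Surjective f ∧ ∀ x, f x = 0 ↔ Φ ^ 3 ∣ x :=
    ⟨ℤ[X] ⧸ Ideal.span {Φ ^ 3}, inferInstance, Ideal.Quotient.mk _, Ideal.Quotient.mk_surjective,
      fun x => by rw [Ideal.Quotient.eq_zero_iff_mem, Ideal.mem_span_singleton]⟩
  have hy : (f X ^ (2 * m + 1) - 1) ^ 3 = 0 := by
    rw [← map_pow, ← map_one f, ← map_sub, ← map_pow, hf, hXp, mul_pow]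
    exact dvd_mul_right _ _
  have hreg : IsLeftRegular (f c) := by
    rw [isLeftRegular_iff_right_eq_zero_of_mul]
    intro x hx
    obtain ⟨x, rfl⟩ := hsurj x
    rw [← map_mul, hf] at hx
    exact (hf x).2 (hprime.pow_dvd_of_dvd_mul_left 3 hndvd hx)
  have he : (f X ^ (2 * m + 1) - 1) ^ 2 * f e =
      (f X ^ (2 * m + 1) - 1) ^ 2 * (((t : ℕ) : ℤ) * f c) := by
    obtain ⟨g, hg⟩ := hdvd
    rw [← sub_eq_zero, ← mul_sub, ← map_pow, ← map_one f, ← map_sub, ← map_pow, Int.cast_natCast,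
      ← map_natCast f, ← map_mul, ← map_sub, ← map_mul, hf, hXp, hg]
    exact ⟨(X - 1) ^ 2 * g, by ring⟩
  rw [← hf, map_sub, qBinom_eq_of_cube_eq_zero f hy hreg (hce _ f) he, h12, hch]
  have hC := congrArg (Nat.cast : ℕ → B)
    (mul_choose_succ_mul_choose_two d s)
  push_cast at hC
  simp only [map_mul, map_add, map_pow, map_sub, map_one, map_natCast, map_ofNat, ← pow_mul]
  rw [show d * s * ((2 * m + 1) * m) = (2 * m + 1) * (m * (d * s)) by ring]
  push_cast
  linear_combination -f X ^ ((2 * m + 1) * (m * (d * s))) * (d + s) * t *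
    (f X ^ (2 * m + 1) - 1) ^ 2 * hC
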